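/- If i, j, k are three distinct elements of {1,…,7} forming a line of the Fano plane, then in 𝒢 one has s_i s_j s_k = 1. In particular s_1 s_5 s_7 = 1. -/

import Mathlib

/-!
Symmetric generation of `M₂₂` (Hasan–Lim).  `G` is the quotient of the free
group on three generators `x, y, t` by the normal closure of the relators
`x^7, y^2, (xy)^3, [x,y]^4, t^2, [t^{x^2}, y x⁻¹], [t, y],
 (y t^{x^2})^5, (x y x^2 t^x)^5, (x t)^8`,
where `a ^ b := b⁻¹ a b` and `[a, b] := a⁻¹ b⁻¹ a b`.
-/

namespace M22

abbrev F := FreeGroup (Fin 3)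
def fx : F := FreeGroup.of 0
def fy : F := FreeGroup.of 1
def ft : F := FreeGroup.of 2

/-- conjugation `a ^ b = b⁻¹ * a * b` -/
def fconj (a b : F) : F := b⁻¹ * a * b
/-- commutator `[a, b] = a⁻¹ * b⁻¹ * a * b` -/
def fcomm (a b : F) : F := a⁻¹ * b⁻¹ * a * b

def rels : Set F :=
  {fx ^ 7, fy ^ 2, (fx * fy) ^ 3, (fcomm fx fy) ^ 4, ft ^ 2,
   fcomm (fconj ft (fx ^ 2)) (fy * fx⁻¹), fcomm ft fy,
   (fy * fconj ft (fx ^ 2)) ^ 5, (fx * fy * fx ^ 2 * fconj ft fx) ^ 5,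
   (fx * ft) ^ 8}

abbrev G := PresentedGroup rels

def x : G := PresentedGroup.of 0
def y : G := PresentedGroup.of 1
def t : G := PresentedGroup.of 2

/-- The symmetric generators `t₁, …, t₁₄`: for `1 ≤ i ≤ 7`, `tᵢ = t ^ (xⁱ)`,
and for `1 ≤ k ≤ 7`, `t₍₇₊ₖ₎ = t ^ (x⁵ y x^(k-1))`; the index is read modulo
`14` with representatives `1, …, 14`. -/
def tt (i : ℕ) : G :=
  let j := (i - 1) % 14 + 1
  if j ≤ 7 then (x ^ j)⁻¹ * t * x ^ j
  else (x ^ 5 * y * x ^ (j - 8))⁻¹ * t * (x ^ 5 * y * x ^ (j - 8))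

/-- `sᵢ = tᵢ t₍ᵢ₊₇₎`. -/
def s (i : ℕ) : G := tt i * tt (i + 7)

/-- the residue of `n` modulo `7`, taken in `{1, …, 7}` -/
def red7 (n : ℕ) : ℕ := (n - 1) % 7 + 1

/-- `{a, b, c}` is a line of the Fano plane on points `{1, …, 7}`; the lines
are the seven triples `{m, m+2, m+3}` for `m = 1, …, 7`, entries reduced
modulo `7` into `{1, …, 7}`. -/
def IsFanoLine (a b c : ℕ) : Prop :=
  ∃ m ∈ Finset.Icc 1 7,
    ({a, b, c} : Finset ℕ) = {red7 m, red7 (m + 2), red7 (m + 3)}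

/-! ### Words and a verified rewriting procedure

Words are lists of letters: `1, …, 14` stand for `t₁, …, t₁₄`, and `15, 16, 17` stand for
`x, x⁻¹, y`. -/

abbrev W := List ℕ

def lv (n : ℕ) : G := if n = 15 then x else if n = 16 then x⁻¹ else if n = 17 then y else tt n

def ev (w : W) : G := (w.map lv).prod

/-- rules: (reversed left-hand side, right-hand side) -/
abbrev Rules := List (W × W)

def Valid (rs : Rules) : Prop := ∀ p ∈ rs, ev p.1.reverse = ev p.2

def strip : W → W → Option W
  | [], w => some w
  | _ :: _, [] => none
  | a :: l, b :: w => cond (Nat.beq a b) (strip l w) none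

def findRule : Rules → W → Option (W × W)
  | [], _ => none
  | p :: rs, st =>
    match strip p.1 st with
    | some st' => some (p.2, st')
    | none => findRule rs st

def run (f : W → Option (W × W)) : ℕ → W → W → W
  | 0, st, inp => st.reverse ++ inp
  | _ + 1, st, [] => st.reverse
  | n + 1, st, c :: inp =>
    match f (c :: st) with
    | some (r, st') => run f n st' (r ++ inp)
    | none => run f n (c :: st) inp

def norm (rs : Rules) (w : W) : W := run (findRule rs) 2000 [] w

def weq : W → W → Bool
  | [], [] => true
  | a :: l, b :: w => cond (Nat.beq a b) (weq l w) false
  | _, _ => false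

lemma weq_eq : ∀ {a b : W}, weq a b = true → a = b
  | [], [], _ => rfl
  | [], _ :: _, h => by simp [weq] at h
  | _ :: _, [], h => by simp [weq] at h
  | a :: l, b :: w, h => by
    cases hb : Nat.beq a b
    · simp [weq, hb] at h
    · rw [Nat.eq_of_beq_eq_true hb, weq_eq (a := l) (b := w) (by simpa [weq, hb] using h)]

@[simp] lemma ev_nil : ev [] = 1 := rfl
@[simp] lemma ev_cons (a : ℕ) (w : W) : ev (a :: w) = lv a * ev w := by simp [ev]
@[simp] lemma ev_append (a b : W) : ev (a ++ b) = ev a * ev b := by simp [ev]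

lemma strip_eq : ∀ {l w r : W}, strip l w = some r → w = l ++ r
  | [], w, r, h => by simpa [strip] using h
  | _ :: _, [], r, h => by simp [strip] at h
  | a :: l, b :: w, r, h => by
    cases hb : Nat.beq a b
    · simp [strip, hb] at h
    · rw [Nat.eq_of_beq_eq_true hb, strip_eq (l := l) (w := w) (by simpa [strip, hb] using h)]
      rfl

lemma findRule_eq : ∀ {rs : Rules} {st r st' : W}, Valid rs → findRule rs st = some (r, st') →
    ev st.reverse = ev st'.reverse * ev r
  | [], _, _, _, _, h => by simp [findRule] at h
  | p :: rs, st, r, st', hv, h => by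
    rw [findRule] at h
    split at h
    next s hs =>
      obtain ⟨h1, h2⟩ := Prod.mk.inj (Option.some.inj h)
      subst h1 h2
      rw [strip_eq hs, List.reverse_append, ev_append, hv p (by simp)]
    next => exact findRule_eq (fun q hq => hv q (by simp [hq])) h

/-- Soundness of a one-step rewriting function acting on (reversed) stacks. -/
def Sound (f : W → Option (W × W)) : Prop :=
  ∀ st r st', f st = some (r, st') → ev st.reverse = ev st'.reverse * ev r

lemma run_eq {f : W → Option (W × W)} (hv : Sound f) : ∀ (n : ℕ) (st inp : W),
    ev (run f n st inp) = ev st.reverse * ev inp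
  | 0, st, inp => by simp [run]
  | n + 1, st, [] => by simp [run]
  | n + 1, st, c :: inp => by
    rw [run]
    split
    next r st' h =>
      have := hv _ _ _ h
      rw [List.reverse_cons, ev_append] at this
      rw [run_eq hv, ev_append, ← mul_assoc, ← this]
      simp [mul_assoc]
    next =>
      rw [run_eq hv]
      simp [mul_assoc]

lemma norm_eq {rs : Rules} (hv : Valid rs) (w : W) : ev (norm rs w) = ev w := by
  have h : Sound (findRule rs) := fun _ _ _ => findRule_eq hv
  simp [norm, run_eq h]

lemma eq_of_norm {rs : Rules} (hv : Valid rs) {a b : W}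
    (h : weq (norm rs a) (norm rs b) = true) : ev a = ev b := by
  rw [← norm_eq hv a, ← norm_eq hv b, weq_eq h]

/-! ### Completion steps -/

def kbStep (rs : Rules) (d : ℕ × ℕ × ℕ × W × W) : Bool :=
  let p := rs.getD d.1 ([], [])
  let q := rs.getD d.2.1 ([], [])
  let s := d.2.2.1
  let l := d.2.2.2.1.reverse
  let r := d.2.2.2.2
  let l₂ := q.1.reverse
  let u := norm rs (p.2 ++ l₂.drop s)
  let v := norm rs ((p.1.drop s).reverse ++ q.2)
  weq (p.1.take s).reverse (l₂.take s) &&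
    ((weq u l && weq v r) || (weq u r && weq v l))

def kbOK : Rules → List (ℕ × ℕ × ℕ × W × W) → Bool
  | _, [] => true
  | rs, (i, j, s, l, r) :: ds => kbStep rs (i, j, s, l, r) && kbOK ((l, r) :: rs) ds

def kbRes : Rules → List (ℕ × ℕ × ℕ × W × W) → Rules
  | rs, [] => rs
  | rs, (_, _, _, l, r) :: ds => kbRes ((l, r) :: rs) ds

lemma valid_getD {rs : Rules} (hv : Valid rs) (i : ℕ) :
    ev (rs.getD i ([], [])).1.reverse = ev (rs.getD i ([], [])).2 := by
  rw [List.getD_eq_getElem?_getD]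
  rcases h : rs[i]? with _ | p
  · simp
  · exact hv p (List.mem_of_getElem? h)

lemma kbStep_eq {rs : Rules} (hv : Valid rs) {d : ℕ × ℕ × ℕ × W × W} (h : kbStep rs d = true) :
    ev d.2.2.2.1.reverse = ev d.2.2.2.2 := by
  obtain ⟨i, j, s, l, r⟩ := d
  have hp := valid_getD hv i
  have hq := valid_getD hv j
  simp only [kbStep, Bool.and_eq_true, Bool.or_eq_true] at h
  generalize rs.getD i ([], []) = p at *
  generalize rs.getD j ([], []) = q at *
  obtain ⟨h0, h⟩ := h
  have h0 := weq_eq h0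
  have key : ev (p.2 ++ q.1.reverse.drop s) = ev ((p.1.drop s).reverse ++ q.2) := by
    rw [ev_append, ev_append, ← hp, ← hq]
    conv_lhs => rw [← List.take_append_drop s p.1, List.reverse_append, ev_append, h0]
    conv_rhs => rw [← List.take_append_drop s q.1.reverse, ev_append]
    rw [mul_assoc]
  rw [← norm_eq hv, ← norm_eq hv (List.reverse _ ++ _)] at key
  rcases h with ⟨h1, h2⟩ | ⟨h1, h2⟩
  · rw [weq_eq h1, weq_eq h2] at key
    exact key
  · rw [weq_eq h1, weq_eq h2] at key
    exact key.symm

lemma kbRes_valid : ∀ {ds : List (ℕ × ℕ × ℕ × W × W)} {rs : Rules}, Valid rs →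
    kbOK rs ds = true → Valid (kbRes rs ds)
  | [], _, hv, _ => hv
  | d :: ds, rs, hv, h => by
    simp only [kbOK, Bool.and_eq_true] at h
    refine kbRes_valid (ds := ds) ?_ h.2
    intro p hp
    rcases List.mem_cons.1 hp with rfl | hp
    · simpa using kbStep_eq hv h.1
    · exact hv p hp

/-! ### The defining relations -/

lemma rel_one {r : F} (h : r ∈ rels) : PresentedGroup.mk rels r = 1 :=
  (PresentedGroup.one_of_mem h)

lemma x7 : x ^ 7 = 1 := rel_one (r := fx ^ 7) (by simp [rels])
lemma y2 : y ^ 2 = 1 := rel_one (r := fy ^ 2) (by simp [rels])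
lemma xy3 : (x * y) ^ 3 = 1 := rel_one (r := (fx * fy) ^ 3) (by simp [rels])
lemma xy4 : (x⁻¹ * y⁻¹ * x * y) ^ 4 = 1 := rel_one (r := (fcomm fx fy) ^ 4) (by simp [rels])
lemma t2 : t ^ 2 = 1 := rel_one (r := ft ^ 2) (by simp [rels])
lemma tz : ((x ^ 2)⁻¹ * t * x ^ 2)⁻¹ * (y * x⁻¹)⁻¹ * ((x ^ 2)⁻¹ * t * x ^ 2) * (y * x⁻¹) = 1 :=
  rel_one (r := fcomm (fconj ft (fx ^ 2)) (fy * fx⁻¹)) (by simp [rels])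
lemma ty : t⁻¹ * y⁻¹ * t * y = 1 := rel_one (r := fcomm ft fy) (by simp [rels])
lemma r1 : (y * ((x ^ 2)⁻¹ * t * x ^ 2)) ^ 5 = 1 :=
  rel_one (r := (fy * fconj ft (fx ^ 2)) ^ 5) (by simp [rels])
lemma r2 : (x * y * x ^ 2 * (x⁻¹ * t * x)) ^ 5 = 1 :=
  rel_one (r := (fx * fy * fx ^ 2 * fconj ft fx) ^ 5) (by simp [rels])
lemma r3 : (x * t) ^ 8 = 1 := rel_one (r := (fx * ft) ^ 8) (by simp [rels])

lemma yi : y⁻¹ = y := inv_eq_of_mul_eq_one_left (by rw [← pow_two, y2])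
lemma ti : t⁻¹ = t := inv_eq_of_mul_eq_one_left (by rw [← pow_two, t2])

lemma tt_inv (n : ℕ) : (tt n)⁻¹ = tt n := by
  unfold tt
  dsimp only
  split <;> simp [mul_assoc, ti]

lemma lv15 : lv 15 = x := rfl
lemma lv16 : lv 16 = x⁻¹ := rfl
lemma lv17 : lv 17 = y := rfl

def linv (c : ℕ) : ℕ := if c = 15 then 16 else if c = 16 then 15 else c

def winv (w : W) : W := (w.map linv).reverse

lemma lv_linv (c : ℕ) : lv (linv c) = (lv c)⁻¹ := by
  unfold linv
  split_ifs with h1 h2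
  · subst h1; rfl
  · subst h2; simp [lv]
  · unfold lv
    rw [if_neg h1, if_neg h2]
    split_ifs
    · exact yi.symm
    · exact (tt_inv c).symm

lemma ev_winv : ∀ w : W, ev (winv w) = (ev w)⁻¹
  | [] => by simp [winv]
  | a :: w => by
    have := ev_winv w
    simp only [winv, List.map_cons, List.reverse_cons, ev_append, ev_cons, ev_nil, mul_one,
      mul_inv_rev] at *
    rw [this, lv_linv]

/-! ### The control group `⟨x, y⟩` -/

def initRules : Rules := [
  ([17, 15, 17, 16, 17, 15, 17, 16], [17, 16, 17, 15, 17, 16, 17, 15]),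
  ([17, 15, 17], [16, 17, 16]),
  ([15, 15, 15, 15], [16, 16, 16]),
  ([17, 17], []),
  ([15, 16], []),
  ([16, 15], [])]

lemma initRules_valid : Valid initRules := by
  intro p hp
  simp only [initRules, List.mem_cons, List.not_mem_nil, or_false] at hp
  rcases hp with rfl | rfl | rfl | rfl | rfl | rfl <;>
    simp only [List.reverse_cons, List.reverse_nil, List.nil_append, List.cons_append, ev_cons,
      ev_nil, mul_one, lv15, lv16, lv17]
  · have h := xy4
    rw [yi] at h
    rw [← mul_inv_eq_one]
    simp only [mul_inv_rev, inv_inv, yi]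
    simpa [pow_succ, mul_assoc] using h
  · have h := xy3
    rw [← mul_inv_eq_one]
    simp only [mul_inv_rev, inv_inv, yi]
    have h2 : x⁻¹ * (x * y) ^ 3 * x = 1 := by rw [h]; simp
    simpa [pow_succ, mul_assoc] using h2
  · have h := x7
    rw [← mul_inv_eq_one]
    simp only [mul_inv_rev, inv_inv]
    simpa [pow_succ, mul_assoc] using h
  · rw [← pow_two, y2]
  · simp
  · simp

/-- The Knuth–Bendix derivation for `⟨x, y⟩`: two earlier rules, overlap length,
new rule (left-hand side reversed). -/
def kbData : List (ℕ × ℕ × ℕ × W × W) := [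
  (3, 1, 1, [16, 17, 16, 17], [15, 17]),
  (2, 4, 1, [17, 16, 17, 16], [17, 15]),
  (4, 7, 1, [16, 16, 16, 16], [15, 15, 15]),
  (2, 7, 1, [17, 16, 17], [15, 17, 15]),
  (5, 0, 1, [15, 17, 15, 15, 17], [16, 17, 16, 16, 17]),
  (1, 6, 1, [16, 17, 16, 16, 17], [15, 17, 15, 15, 17]),
  (6, 7, 3, [16, 17, 16, 16, 16, 17, 16, 16], [15, 17, 15, 15, 15, 17, 15, 15]),
  (2, 9, 1, [15, 15, 15, 17, 16, 16, 17, 16], [17, 15, 15, 17, 16, 16, 16]),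
  (2, 5, 1, [16, 16, 16, 17, 15, 15, 17, 15], [17, 16, 16, 17, 15, 15, 15]),
  (14, 9, 1, [15, 15, 17, 15, 15, 15, 17, 15, 15], [16, 17, 16, 16, 16, 17, 16]),
  (10, 13, 1, [17, 15, 15, 17, 15, 15, 15, 17, 15], [16, 16, 17, 16, 16, 17, 15]),
  (4, 15, 1, [15, 15, 15, 17, 15, 15, 15, 17, 15], [16, 16, 17, 16, 16, 16, 17]),
  (10, 12, 2, [17, 15, 15, 17, 15, 15, 15, 17], [16, 16, 16, 17, 16, 16, 17, 15]),
  (16, 0, 1, [15, 17, 16, 16, 17, 16, 16, 16, 17], [15, 15, 15, 17, 15, 15, 17]),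
  (1, 9, 4, [15, 15, 17, 16, 16, 17, 16, 16, 16], [17, 15, 15, 17, 16, 16, 17]),
  (12, 8, 2, [16, 17, 16, 16, 16, 17, 15, 15, 15], [16, 17, 15, 15, 15, 17, 15, 15]),
  (10, 8, 3, [16, 16, 16, 17, 15, 15, 15, 17, 15], [16, 16, 17, 16, 16, 16, 17, 15]),
  (7, 22, 1, [16, 16, 17, 16, 16, 16, 17, 16], [15, 15, 17, 15, 15, 15, 17, 15]),
  (23, 0, 1, [15, 17, 15, 15, 15, 17, 15, 15, 15], [17, 16, 16, 16, 17, 16, 16]),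
  (8, 14, 4, [15, 15, 17, 16, 16, 17, 16, 16], [15, 17, 15, 15, 17, 16, 16, 17]),
  (25, 0, 1, [17, 16, 16, 17, 15, 15, 17, 15, 15], [16, 17, 16, 16, 17, 15, 15]),
  (1, 13, 7, [15, 17, 16, 16, 17, 15, 15, 17, 15], [16, 17, 15, 15, 17, 16, 16, 16]),
  (26, 10, 1, [15, 15, 15, 17, 15, 15, 15, 17], [16, 16, 16, 17, 16, 16, 16, 17]),
  (26, 0, 1, [17, 16, 16, 16, 17, 16, 16, 16, 17], [15, 15, 15, 17, 15, 15, 15]),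
  (1, 26, 3, [15, 17, 16, 16, 16, 17, 16, 16, 16], [17, 15, 15, 15, 17, 16, 16, 16]),
  (21, 12, 1, [15, 17, 16, 16, 17, 15, 15, 15, 17], [15, 17, 16, 16, 16, 17, 15, 15, 17]),
  (12, 31, 1, [17, 16, 16, 17, 16, 16, 16, 17], [15, 15, 15, 17, 15, 15, 17, 16]),
  (0, 21, 4, [16, 16, 17, 15, 15, 17, 15, 15, 15], [17, 16, 16, 17, 15, 15, 17]),
  (25, 13, 3, [15, 15, 17, 16, 16, 17, 15, 15, 15], [16, 17, 15, 15, 17, 16, 16, 17]),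
  (14, 21, 7, [16, 16, 16, 17, 15, 15, 17, 16, 16], [17, 15, 15, 17, 16, 16, 17, 15]),
  (34, 14, 1, [15, 15, 17, 15, 15, 15, 17, 16, 16], [15, 15, 17, 16, 16, 16, 17, 16]),
  (14, 35, 1, [15, 15, 17, 16, 16, 16, 17, 16, 16], [15, 17, 15, 15, 15, 17, 16, 16]),
  (14, 29, 2, [15, 15, 15, 17, 16, 16, 16, 17, 16], [15, 15, 17, 15, 15, 15, 17, 16]),
  (15, 27, 3, [17, 15, 15, 17, 16, 16, 17, 16], [15, 15, 17, 15, 15, 17, 16, 16]),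
  (15, 39, 1, [16, 16, 16, 17, 16, 16, 16, 17], [15, 15, 15, 17, 15, 15, 15, 17]),
  (0, 32, 3, [16, 17, 15, 15, 15, 17, 15, 15, 15], [17, 16, 16, 16, 17, 15, 15, 15]),
  (38, 17, 3, [15, 17, 15, 15, 15, 17, 16, 16, 16], [15, 17, 16, 16, 16, 17, 16, 16]),
  (15, 38, 2, [16, 17, 15, 15, 15, 17, 16, 16, 17], [16, 17, 15, 15, 17, 16, 16, 16, 17]),
  (34, 15, 1, [17, 16, 16, 16, 17, 15, 15, 15, 17], [15, 17, 16, 16, 16, 17, 15, 15, 15]),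
  (14, 40, 2, [16, 17, 15, 15, 15, 17, 16, 16, 16], [15, 17, 16, 16, 16, 17, 15, 15, 15]),
  (37, 15, 3, [16, 16, 16, 17, 15, 15, 15, 17, 16], [15, 15, 15, 17, 16, 16, 16, 17, 15]),
  (15, 46, 1, [16, 17, 15, 15, 17, 16, 16, 16, 17, 15], [17, 15, 15, 15, 17, 16, 16, 17]),
  (43, 15, 1, [16, 17, 15, 15, 17, 16, 16, 16, 17], [16, 17, 15, 15, 15, 17, 16, 16, 17]),
  (45, 15, 3, [16, 16, 17, 15, 15, 17, 16, 16, 16], [15, 17, 16, 16, 17, 15, 15, 17]),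
  (16, 35, 7, [15, 15, 15, 17, 16, 16, 17, 15, 15], [17, 16, 16, 17, 15, 15, 17, 16]),
  (49, 16, 1, [17, 16, 16, 17, 15, 15, 17, 16, 16], [15, 15, 17, 16, 16, 17, 15, 15]),
  (16, 50, 1, [15, 15, 17, 16, 16, 17, 15, 15, 17], [16, 16, 17, 15, 15, 17, 16, 16]),
  (16, 52, 1, [16, 16, 17, 16, 16, 16, 17, 15, 15], [16, 16, 17, 15, 15, 15, 17, 15]),
  (53, 16, 1, [16, 16, 17, 15, 15, 15, 17, 15, 15], [16, 17, 16, 16, 16, 17, 15, 15]),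
  (15, 45, 1, [15, 17, 16, 16, 16, 17, 15, 15, 17], [15, 17, 16, 16, 17, 15, 15, 15, 17]),
  (51, 15, 1, [17, 15, 15, 15, 17, 16, 16, 16, 17], [15, 15, 15, 17, 16, 16, 16, 17, 15]),
  (34, 12, 8, [15, 15, 15, 17, 16, 16, 16, 17, 15, 15], [16, 16, 17, 15, 15, 15, 17, 16]),
  (11, 56, 1, [15, 15, 17, 16, 16, 16, 17, 15, 15, 15], [16, 17, 15, 15, 15, 17, 16, 16]),
  (58, 9, 1, [17, 15, 15, 17, 16, 16, 17, 15, 15], [16, 16, 17, 15, 15, 17, 16, 16]),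
  (10, 24, 8, [15, 17, 16, 16, 17, 15, 15, 17, 16], [15, 17, 16, 16, 17, 15, 15, 17, 16]),
  (10, 60, 1, [16, 16, 17, 15, 15, 17, 16, 16, 17], [15, 15, 17, 16, 16, 17, 15, 15]),
  (1, 57, 2, [16, 17, 16, 16, 16, 17, 15, 15, 17, 16], [15, 17, 16, 16, 17, 15, 15, 15, 17, 15]),
  (53, 2, 2, [17, 16, 16, 17, 15, 15, 15, 17, 16, 16], [15, 15, 17, 16, 16, 16, 17, 15, 15, 17]),
  (41, 42, 7, [16, 16, 17, 15, 15, 15, 17, 16, 16], [15, 15, 17, 16, 16, 16, 17, 15, 15])]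

/-- `(i, b, j, c)`: conjugation by the letter `b` carries `tᵢ` to `tⱼ`, and `gᵢ b = c gⱼ` with `c`
in the centraliser of `t`. -/
def conjData : List (ℕ × ℕ × ℕ × List Bool) := [
  (1, 15, 2, []),
  (1, 16, 7, []),
  (1, 17, 12, [false, true, false, false]),
  (2, 15, 3, []),
  (2, 16, 1, []),
  (2, 17, 3, [false]),
  (3, 15, 4, []),
  (3, 16, 2, []),
  (3, 17, 2, [false, false]),
  (4, 15, 5, []),
  (4, 16, 3, []),
  (4, 17, 11, [true, false, false]),
  (5, 15, 6, []),
  (5, 16, 4, []),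
  (5, 17, 8, []),
  (6, 15, 7, []),
  (6, 16, 5, []),
  (6, 17, 13, [false, false, true, false]),
  (7, 15, 1, []),
  (7, 16, 6, []),
  (7, 17, 7, [true]),
  (8, 15, 9, []),
  (8, 16, 14, []),
  (8, 17, 5, []),
  (9, 15, 10, []),
  (9, 16, 8, []),
  (9, 17, 10, [true, false, false]),
  (10, 15, 11, []),
  (10, 16, 9, []),
  (10, 17, 9, [false, true]),
  (11, 15, 12, []),
  (11, 16, 10, []),
  (11, 17, 4, [false, true]),
  (12, 15, 13, []),
  (12, 16, 11, []),
  (12, 17, 1, [false, true, false, false]),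
  (13, 15, 14, []),
  (13, 16, 12, []),
  (13, 17, 6, [false, false, true, false]),
  (14, 15, 8, []),
  (14, 16, 13, []),
  (14, 17, 14, [false, false, true, false])]

/-- Derivation of further relators: `(i, c, j, f, d, w)` means that
`w` is the normal form of `(Aᶜ)⁻¹ Bᵈ`, where `A` is the `i`-th relator and `B` the `j`-th one
(inverted if `f`), counted from the most recent. -/
def relData : List (ℕ × W × ℕ × Bool × W × W) := [
  (1, [17, 12], 2, false, [16, 16, 17, 15, 15, 17, 16, 16],
    [15, 17, 15, 15, 17, 1, 5, 8, 1, 12, 1]),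
  (0, [8], 0, true, [16, 17, 15, 1],
    [8, 1, 8, 1]),
  (1, [15, 15, 15, 11], 4, false, [16, 16],
    [15, 15, 17, 16, 16, 17, 11, 4, 14, 4, 11, 1, 7, 1, 7]),
  (2, [17, 15, 15, 15, 8], 2, true, [15, 15, 17, 16, 16, 17, 15, 8],
    [15, 15, 17, 16, 16, 17, 15, 5, 8, 1, 12, 2, 8, 1, 9]),
  (1, [16, 17, 16, 8, 1, 13], 0, false, [16, 16, 16, 17, 12, 1, 8, 5, 10],
    [13, 1, 8, 12, 6, 1, 8, 5, 10]),
  (4, [17, 15, 15, 15, 8], 4, true, [16, 16, 16, 17, 16, 16, 16, 17, 8],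
    [17, 16, 16, 17, 15, 15, 15, 17, 6, 8, 1, 13, 14, 8, 1, 7]),
  (1, [13], 0, false, [16, 16, 17, 15, 15, 5],
    [16, 17, 15, 15, 15, 17, 16, 10, 5, 13, 10, 5]),
  (7, [15, 15], 9, false, [16, 16],
    [15, 17, 16, 16, 7, 9, 13, 11, 5, 10, 7, 1, 7]),
  (1, [17, 15, 15, 10], 0, true, [15, 1, 2, 1, 11, 6, 12, 14],
    [16, 17, 15, 15, 15, 17, 15, 15, 3, 4, 2, 1, 11, 6, 12, 14]),
  (2, [17, 15, 15], 11, true, [16, 16, 17, 15],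
    [17, 15, 15, 17, 4, 13, 14, 4, 1, 13, 1, 13]),
  (1, [15, 17, 5, 6], 0, false, [15, 15, 17, 16, 16, 16, 5, 3],
    [16, 16, 16, 17, 15, 12, 9, 1, 14, 6, 2, 5, 3]),
  (11, [15, 15, 2], 12, false, [15, 15, 15, 17, 16, 16, 16],
    [17, 16, 16, 16, 17, 15, 15, 8, 7, 3, 11, 13, 12, 1, 9, 8]),
  (1, [17, 16, 6, 11], 0, false, [15, 15, 15, 6, 7],
    [17, 16, 16, 17, 15, 15, 15, 6, 7, 11, 6, 7]),
  (6, [17, 15, 15], 12, false, [17, 16, 16, 17, 15, 15, 4],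
    [15, 17, 4, 1, 3, 11, 8, 11, 4]),
  (1, [15, 17], 0, false, [16, 17, 15, 15, 17, 16, 16, 16, 5],
    [12, 7, 14, 1, 8, 5])]

def nRules : Rules := kbRes initRules kbData

lemma nRules_valid : Valid nRules := kbRes_valid initRules_valid (by decide +kernel)

/-! ### The action on the symmetric generators -/

def gw (i : ℕ) : W :=
  if i ≤ 7 then List.replicate i 15 else List.replicate 5 15 ++ 17 :: List.replicate (i - 8) 15

lemma ev_replicate (n : ℕ) : ev (List.replicate n 15) = x ^ n := by
  simp [ev, lv15]

lemma tt_eq {i : ℕ} (h1 : 1 ≤ i) (h2 : i ≤ 14) : tt i = (ev (gw i))⁻¹ * t * ev (gw i) := by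
  have h : (i - 1) % 14 + 1 = i := by omega
  unfold tt gw
  simp only [h]
  split_ifs
  · rw [ev_replicate]
  · rw [ev_append, ev_cons, ev_replicate, ev_replicate, lv17]
    simp only [mul_assoc]

def cw (c : List Bool) : W :=
  c.flatMap fun b => cond b [17] [15, 15, 17, 16, 16, 16]

lemma cw_comm : ∀ c : List Bool, Commute t (ev (cw c))
  | [] => Commute.one_right t
  | b :: c => by
    have e : cw (b :: c) = cond b [17] [15, 15, 17, 16, 16, 16] ++ cw c := rfl
    rw [e, ev_append]
    refine Commute.mul_right ?_ (cw_comm c)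
    cases b
    · simp only [cond, ev_cons, ev_nil, lv15, lv16, lv17, mul_one]
      have h := tz
      have h' : x ^ 2 * (((x ^ 2)⁻¹ * t * x ^ 2)⁻¹ * (y * x⁻¹)⁻¹ * ((x ^ 2)⁻¹ * t * x ^ 2) *
        (y * x⁻¹)) * (x ^ 2)⁻¹ = 1 := by rw [h]; simp
      have h2 : (t * (x * (x * (y * (x⁻¹ * (x⁻¹ * x⁻¹))))))  *
          ((x * (x * (y * (x⁻¹ * (x⁻¹ * x⁻¹))))) * t)⁻¹ =
          (x * (x * (y * (x⁻¹ * (x⁻¹ * x⁻¹))))) * t * (x ^ 2 * (((x ^ 2)⁻¹ * t * x ^ 2)⁻¹ *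
          (y * x⁻¹)⁻¹ * ((x ^ 2)⁻¹ * t * x ^ 2) *
        (y * x⁻¹)) * (x ^ 2)⁻¹) * ((x * (x * (y * (x⁻¹ * (x⁻¹ * x⁻¹))))) * t)⁻¹ := by
        simp [pow_succ, mul_assoc]
      rw [h', mul_one, mul_inv_cancel] at h2
      exact mul_inv_eq_one.1 h2
    · simp only [cond, ev_cons, ev_nil, lv17, mul_one]
      have h := ty
      have h2 : t * y = y * t * (t⁻¹ * y⁻¹ * t * y) := by group
      rw [h, mul_one] at h2
      exact h2

def conjOK (d : ℕ × ℕ × ℕ × List Bool) : Bool :=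
  Nat.ble 1 d.1 && Nat.ble d.1 14 && Nat.ble 1 d.2.2.1 && Nat.ble d.2.2.1 14 &&
    weq (norm nRules (gw d.1 ++ [d.2.1])) (norm nRules (cw d.2.2.2 ++ gw d.2.2.1))

lemma conj_eq {d : ℕ × ℕ × ℕ × List Bool} (h : conjOK d = true) :
    ev [d.1, d.2.1] = ev [d.2.1, d.2.2.1] := by
  obtain ⟨i, b, j, c⟩ := d
  simp only [conjOK, Bool.and_eq_true, Nat.ble_eq] at h
  obtain ⟨⟨⟨⟨h1, h2⟩, h3⟩, h4⟩, h5⟩ := h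
  have h5 := eq_of_norm nRules_valid h5
  have ei : lv i = tt i := by
    unfold lv
    rw [if_neg (by omega), if_neg (by omega), if_neg (by omega)]
  have ej : lv j = tt j := by
    unfold lv
    rw [if_neg (by omega), if_neg (by omega), if_neg (by omega)]
  simp only [ev_append, ev_cons, ev_nil, mul_one] at *
  rw [ei, ej, tt_eq h1 h2, tt_eq h3 h4]
  have hc := (cw_comm c).eq
  have hj : ev (gw i) = ev (cw c) * ev (gw j) * (lv b)⁻¹ := by rw [← h5]; group
  rw [hj]
  have : (ev (cw c))⁻¹ * t * ev (cw c) = t := by rw [mul_assoc, hc]; group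
  calc _ = lv b * (ev (gw j))⁻¹ * ((ev (cw c))⁻¹ * t * ev (cw c)) * ev (gw j) := by group
    _ = _ := by rw [this]; group

lemma conjData_ok : conjData.all conjOK = true := by decide +kernel

/-- One rewriting step for the whole group: cancel `tᵢ tᵢ`, move `x, x⁻¹, y` to the left of the
`tᵢ`, and rewrite in the control group. -/
def findAll : W → Option (W × W)
  | c :: d :: st =>
    cond (Nat.ble c 14)
      (cond (Nat.beq c d) (some ([], st)) none)
      (cond (Nat.ble d 14)
        (match conjData[3 * d + c - 18]? with
          | some (i, b, j, _) => cond (Nat.beq i d && Nat.beq b c) (some ([b, j], st)) none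
          | none => none)
        (findRule nRules (c :: d :: st)))
  | _ => none

lemma findAll_sound : Sound findAll
  | [], _, _, h => by simp [findAll] at h
  | [_], _, _, h => by simp [findAll] at h
  | c :: d :: st, r, st', h => by
    rw [findAll] at h
    cases h1 : Nat.ble c 14
    · cases h2 : Nat.ble d 14
      · rw [h1, h2] at h
        exact findRule_eq nRules_valid h
      · rw [h1, h2] at h
        simp only [cond] at h
        rcases h3 : conjData[3 * d + c - 18]? with _ | ⟨i, b, j, w⟩
        · simp [h3] at h
        · have hm := conj_eq (List.all_eq_true.1 conjData_ok _ (List.mem_of_getElem? h3))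
          simp only [h3] at h
          cases h4 : (Nat.beq i d && Nat.beq b c)
          · simp [h4] at h
          · rw [h4] at h
            simp only [Bool.and_eq_true] at h4
            obtain ⟨h5, h6⟩ := Prod.mk.inj (Option.some.inj h)
            subst h5 h6
            have e1 := Nat.eq_of_beq_eq_true h4.1
            have e2 := Nat.eq_of_beq_eq_true h4.2
            subst e1 e2
            simp only [ev_cons, ev_nil, mul_one] at hm
            simp [mul_assoc, hm]
    · rw [h1] at h
      cases h2 : Nat.beq c d
      · simp [h2] at h
      · simp only [h2, cond] at h
        obtain ⟨h5, h6⟩ := Prod.mk.inj (Option.some.inj h)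
        subst h5 h6
        have e1 := Nat.eq_of_beq_eq_true h2
        subst e1
        have hc : c ≤ 14 := Nat.le_of_ble_eq_true h1
        have hl : lv c = tt c := by
          unfold lv
          rw [if_neg (by omega), if_neg (by omega), if_neg (by omega)]
        have hs : tt c * tt c = 1 := by
          nth_rewrite 1 [← tt_inv c]
          simp
        simp [mul_assoc, hl, hs]

def normAll (w : W) : W := run findAll 2000 [] w

lemma normAll_eq (w : W) : ev (normAll w) = ev w := by
  simp [normAll, run_eq findAll_sound]

/-! ### Deriving the relators -/

def conjW (w u : W) : W := winv u ++ (w ++ u)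

lemma ev_conjW {w : W} (h : ev w = 1) (u : W) : ev (conjW w u) = 1 := by
  simp [conjW, ev_winv, h]

def relStep (ws : List W) (d : ℕ × W × ℕ × Bool × W × W) : Bool :=
  let a := ws.getD d.1 []
  let b := ws.getD d.2.2.1 []
  weq (normAll (conjW (winv a) d.2.1 ++ conjW (cond d.2.2.2.1 (winv b) b) d.2.2.2.2.1))
    d.2.2.2.2.2

def relOK : List W → List (ℕ × W × ℕ × Bool × W × W) → Bool
  | _, [] => true
  | ws, d :: ds => relStep ws d && relOK (d.2.2.2.2.2 :: ws) ds

lemma ev_getD {ws : List W} (hv : ∀ w ∈ ws, ev w = 1) (i : ℕ) : ev (ws.getD i []) = 1 := by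
  rw [List.getD_eq_getElem?_getD]
  rcases h : ws[i]? with _ | p
  · simp
  · exact hv p (List.mem_of_getElem? h)

lemma relStep_eq {ws : List W} (hv : ∀ w ∈ ws, ev w = 1) {d : ℕ × W × ℕ × Bool × W × W}
    (h : relStep ws d = true) : ev d.2.2.2.2.2 = 1 := by
  obtain ⟨i, c, j, f, e, w⟩ := d
  have ha := ev_getD hv i
  have hb := ev_getD hv j
  simp only [relStep] at h
  generalize ws.getD i [] = a at *
  generalize ws.getD j [] = b at *
  rw [← weq_eq h, normAll_eq, ev_append, ev_conjW, ev_conjW, one_mul]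
  · cases f
    · exact hb
    · simp only [cond, ev_winv, hb, inv_one]
  · rw [ev_winv, ha, inv_one]

lemma relOK_eq : ∀ {ds : List (ℕ × W × ℕ × Bool × W × W)} {ws : List W},
    (∀ w ∈ ws, ev w = 1) → relOK ws ds = true → ∀ d ∈ ds, ev d.2.2.2.2.2 = 1
  | [], _, _, _, _, hd => by simp at hd
  | d :: ds, ws, hv, h, d', hd => by
    simp only [relOK, Bool.and_eq_true] at h
    have h1 := relStep_eq hv h.1
    rcases List.mem_cons.1 hd with rfl | hd
    · exact h1
    · refine relOK_eq (ds := ds) (ws := d.2.2.2.2.2 :: ws) ?_ h.2 d' hd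
      intro w hw
      rcases List.mem_cons.1 hw with rfl | hw
      · exact h1
      · exact hv w hw

def initRels : List W := [
  [15, 7, 15, 7, 15, 7, 15, 7, 15, 7, 15, 7, 15, 7, 15, 7],
  [15, 17, 15, 15, 1, 15, 17, 15, 15, 1, 15, 17, 15, 15, 1, 15, 17, 15, 15, 1, 15, 17, 15, 15, 1],
  [17, 2, 17, 2, 17, 2, 17, 2, 17, 2]]

lemma lv1 : lv 1 = x⁻¹ * t * x := by
  change tt 1 = _
  simp [tt]

lemma lv2 : lv 2 = (x ^ 2)⁻¹ * t * x ^ 2 := by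
  change tt 2 = _
  simp [tt]

lemma lv7 : lv 7 = t := by
  change tt 7 = _
  simp [tt, x7]

lemma initRels_eq : ∀ w ∈ initRels, ev w = 1 := by
  intro w hw
  simp only [initRels, List.mem_cons, List.not_mem_nil, or_false] at hw
  rcases hw with rfl | rfl | rfl
  · have h := r3
    rw [← lv7, ← lv15] at h
    simpa only [pow_succ, pow_zero, one_mul, mul_assoc, ev_cons, ev_nil, mul_one] using h
  · have h := r2
    rw [← lv1, ← lv15, ← lv17] at h
    simpa only [pow_succ, pow_zero, one_mul, mul_assoc, ev_cons, ev_nil, mul_one] using h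
  · have h := r1
    rw [← lv2, ← lv17] at h
    simpa only [pow_succ, pow_zero, one_mul, mul_assoc, ev_cons, ev_nil, mul_one] using h

lemma relData_eq : ∀ d ∈ relData, ev d.2.2.2.2.2 = 1 :=
  relOK_eq initRels_eq (by decide +kernel)

lemma w4 : ev [8, 1, 8, 1] = 1 := by
  have := relData_eq (relData.getD 1 default) (by decide)
  exact this

lemma w6 : ev [12, 7, 14, 1, 8, 5] = 1 := by
  have := relData_eq (relData.getD 14 default) (by decide)
  exact this

/-- Transfer a relator to a conjugate one. -/
lemma transfer {w : W} (h : ev w = 1) (u v : W)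
    (hn : weq (normAll (conjW w u)) (normAll v) = true) : ev v = 1 := by
  rw [← normAll_eq v, ← weq_eq hn, normAll_eq, ev_conjW h]

lemma s_eq {i : ℕ} (h1 : 1 ≤ i) (h7 : i ≤ 7) : s i = lv i * lv (i + 7) := by
  unfold lv s
  rw [if_neg (by omega), if_neg (by omega), if_neg (by omega), if_neg (by omega),
    if_neg (by omega), if_neg (by omega)]

lemma s_sq {i : ℕ} (h1 : 1 ≤ i) (h7 : i ≤ 7) : s i * s i = 1 := by
  have : ev [i, i + 7, i, i + 7] = 1 := by
    refine transfer w4 ([17, 15, 15, 15] ++ List.replicate (i - 1) 15) _ ?_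
    interval_cases i <;> decide +kernel
  rw [s_eq h1 h7]
  simpa [mul_assoc] using this

lemma s_line {m : ℕ} (h1 : 1 ≤ m) (h7 : m ≤ 7) :
    s (red7 m) * s (red7 (m + 2)) * s (red7 (m + 3)) = 1 := by
  have : ev [red7 m, red7 m + 7, red7 (m + 2), red7 (m + 2) + 7,
      red7 (m + 3), red7 (m + 3) + 7] = 1 := by
    refine transfer w6 ([12, 15, 17, 16, 16, 16, 17, 15, 15, 17] ++ List.replicate (m - 1) 15) _ ?_
    interval_cases m <;> decide +kernel
  have hr : ∀ n, 1 ≤ red7 n ∧ red7 n ≤ 7 := fun n => by unfold red7; omega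
  rw [s_eq (hr _).1 (hr _).2, s_eq (hr _).1 (hr _).2, s_eq (hr _).1 (hr _).2]
  simpa [mul_assoc] using this

lemma perm_prod {H : Type*} [Group H] {a b c : H} (ha : a * a = 1) (hb : b * b = 1)
    (hc : c * c = 1) (h : a * b * c = 1) :
    a * c * b = 1 ∧ b * a * c = 1 ∧ b * c * a = 1 ∧ c * a * b = 1 ∧ c * b * a = 1 := by
  have ia : a⁻¹ = a := inv_eq_of_mul_eq_one_left ha
  have ib : b⁻¹ = b := inv_eq_of_mul_eq_one_left hb
  have ic : c⁻¹ = c := inv_eq_of_mul_eq_one_left hc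
  have e1 : c * a * b = 1 := by
    have : c * a * b = c * (a * b * c) * c⁻¹ := by group
    rw [this, h]; group
  have e2 : b * c * a = 1 := by
    have : b * c * a = a⁻¹ * (a * b * c) * a := by group
    rw [this, h]; group
  have inv3 : ∀ {p q r : H}, p⁻¹ = p → q⁻¹ = q → r⁻¹ = r → p * q * r = 1 → r * q * p = 1 := by
    intro p q r hp hq hr h
    have := congrArg (·⁻¹) h
    simpa [mul_assoc, hp, hq, hr] using this
  exact ⟨inv3 ib ic ia e2, inv3 ic ia ib e1, e2, e1, inv3 ia ib ic h⟩

lemma lines {i j k : ℕ} (hij : i ≠ j) (hik : i ≠ k) (hjk : j ≠ k) (h : IsFanoLine i j k) :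
    s i * s j * s k = 1 := by
  obtain ⟨m, hm, h⟩ := h
  obtain ⟨h1, h7⟩ := Finset.mem_Icc.1 hm
  have hr : ∀ n, 1 ≤ red7 n ∧ red7 n ≤ 7 := fun n => by unfold red7; omega
  have hl := s_line h1 h7
  have hp := perm_prod (s_sq (hr m).1 (hr m).2) (s_sq (hr (m + 2)).1 (hr (m + 2)).2)
    (s_sq (hr (m + 3)).1 (hr (m + 3)).2) hl
  generalize red7 m = a at *
  generalize red7 (m + 2) = b at *
  generalize red7 (m + 3) = c at *
  obtain ⟨p1, p2, p3, p4, p5⟩ := hp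
  have hi : i ∈ ({a, b, c} : Finset ℕ) := by rw [← h]; simp
  have hj : j ∈ ({a, b, c} : Finset ℕ) := by rw [← h]; simp
  have hk : k ∈ ({a, b, c} : Finset ℕ) := by rw [← h]; simp
  simp only [Finset.mem_insert, Finset.mem_singleton] at hi hj hk
  clear h
  rcases hi with rfl | rfl | rfl <;> rcases hj with rfl | rfl | rfl <;>
    rcases hk with rfl | rfl | rfl <;> first | contradiction | assumption

/-- If `i, j, k` are three distinct points forming a line of the Fano plane,
then `sᵢ sⱼ sₖ = 1` in `G`; in particular `s₁ s₅ s₇ = 1`. -/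
theorem s_line_prod :
    (∀ i ∈ Finset.Icc 1 7, ∀ j ∈ Finset.Icc 1 7, ∀ k ∈ Finset.Icc 1 7,
      i ≠ j → i ≠ k → j ≠ k → IsFanoLine i j k → s i * s j * s k = 1) ∧
    s 1 * s 5 * s 7 = 1 := by
  refine ⟨fun i _ j _ k _ hij hik hjk h => lines hij hik hjk h, ?_⟩
  exact lines (by decide) (by decide) (by decide) ⟨5, by decide, by decide⟩

end M22
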